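/- Let (L,π_1,π_2,α) be a compatible Hom-Leibniz algebra (π_1 = [·,·], π_2 = {·,·}) and (M,m_L^1,m_R^1,m_L^2,m_R^2,β) a compatible bimodule over it. Then the pair of lifted cochains (π̂_1 + m̂_L^1 + m̂_R^1, π̂_2 + m̂_L^2 + m̂_R^2) is a Maurer–Cartan element of the bi-differential graded Lie algebra (C_{α⊕β}^*(L⊕M, L⊕M), [·,·]_B, 0, 0); explicitly, [π̂_1 + m̂_L^1 + m̂_R^1, π̂_1 + m̂_L^1 + m̂_R^1]_B = 0, [π̂_1 + m̂_L^1 + m̂_R^1, π̂_2 + m̂_L^2 + m̂_R^2]_B = 0, and [π̂_2 + m̂_L^2 + m̂_R^2, π̂_2 + m̂_L^2 + m̂_R^2]_B = 0. -/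

import Mathlib

open Finset

variable {K : Type*} [Field K] [CharZero K]
variable {L : Type*} [AddCommGroup L] [Module K L]
variable {M : Type*} [AddCommGroup M] [Module K M]

/-- `σ` is an `(i, m-i)`-shuffle. -/
def IsShuffle {m : ℕ} (i : ℕ) (σ : Equiv.Perm (Fin m)) : Prop :=
  (∀ a b : Fin m, a < b → (b : ℕ) < i → σ a < σ b) ∧
  (∀ a b : Fin m, a < b → i ≤ (a : ℕ) → σ a < σ b)

instance {m : ℕ} (i : ℕ) (σ : Equiv.Perm (Fin m)) : Decidable (IsShuffle i σ) := by
  unfold IsShuffle; infer_instance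

/-- The circle product `P ∘ Q = Σ_{k=1}^{p+1} (−1)^{(k−1)q} P∘_k Q` of Balavoine, where
`(P∘_k Q)(x_1,…,x_{p+q+1}) = Σ_{σ ∈ S(k−1,q)} (−1)^σ P(α^p x_{σ(1)},…,α^p x_{σ(k−1)},
Q(x_{σ(k)},…,x_{σ(k+q−1)},x_{k+q}), α^p x_{k+q+1},…,α^p x_{p+q+1})`. -/
noncomputable def hcomp (α : L → L) (p q : ℕ)
    (P : (Fin (p + 1) → L) → L) (Q : (Fin (q + 1) → L) → L) :
    (Fin (p + q + 1) → L) → L :=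
  fun x => ∑ j : Fin (p + 1), (-1 : ℤ) ^ ((j : ℕ) * q) •
    ∑ σ ∈ Finset.univ.filter (fun σ : Equiv.Perm (Fin ((j : ℕ) + q)) => IsShuffle (j : ℕ) σ),
      ((Equiv.Perm.sign σ : ℤ)) •
        P (fun i : Fin (p + 1) =>
          if h : (i : ℕ) < (j : ℕ) then
            α^[p] (x (Fin.castLE (by have := j.isLt; omega)
              (σ ⟨(i : ℕ), by have := j.isLt; omega⟩)))
          else if (i : ℕ) = (j : ℕ) then
            Q (fun a : Fin (q + 1) =>
              if ha : (a : ℕ) < q then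
                x (Fin.castLE (by have := j.isLt; omega)
                  (σ ⟨(j : ℕ) + (a : ℕ), by omega⟩))
              else x ⟨(j : ℕ) + q, by have := j.isLt; omega⟩)
          else α^[p] (x ⟨(i : ℕ) + q, by have := i.isLt; omega⟩))

/-- Reindexing a cochain along an equality of arities. -/
def recast {m n : ℕ} (h : m = n) (f : (Fin m → L) → L) : (Fin n → L) → L :=
  fun x => f (fun i => x (Fin.cast h i))

/-- The Balavoine bracket `[P,Q]_B = P∘Q − (−1)^{pq} Q∘P` for `P` of degree `p`
(arity `p+1`) and `Q` of degree `q` (arity `q+1`). -/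
noncomputable def balavoine (α : L → L) (p q : ℕ)
    (P : (Fin (p + 1) → L) → L) (Q : (Fin (q + 1) → L) → L) :
    (Fin (p + q + 1) → L) → L :=
  hcomp α p q P Q - ((-1 : ℤ) ^ (p * q)) • recast (by omega) (hcomp α q p Q P)

/-- View a bilinear operation as a 2-cochain. -/
def c2 {L : Type*} (b : L → L → L) : (Fin 2 → L) → L := fun x => b (x 0) (x 1)

/-- A bilinear map, phrased for plain curried functions. -/
def IsBilinMap (K : Type*) [Field K] {L M N : Type*} [AddCommGroup L] [Module K L]
    [AddCommGroup M] [Module K M] [AddCommGroup N] [Module K N] (b : L → M → N) : Prop :=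
  (∀ x, IsLinearMap K (b x)) ∧ (∀ y, IsLinearMap K (fun x => b x y))

/-- An `n`-multilinear map, phrased for plain functions. -/
def IsMultilin (K : Type*) [Field K] {L : Type*} [AddCommGroup L] [Module K L]
    {n : ℕ} (f : (Fin n → L) → L) : Prop :=
  ∀ (x : Fin n → L) (i : Fin n), IsLinearMap K (fun v => f (Function.update x i v))

/-- Membership condition for `C_α^n(L,L)`: the map commutes with `α`,
i.e. `α ∘ f = f ∘ α^{⊗n}`. -/
def CommutesWith {L : Type*} (α : L → L) {n : ℕ} (f : (Fin n → L) → L) : Prop :=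
  ∀ x, α (f x) = f (fun i => α (x i))

/-- A multiplicative Hom-Leibniz algebra structure `(L, b, α)`:
`α` linear, `b` bilinear, `α` multiplicative for `b`, and the Hom-Leibniz identity. -/
def IsHomLeibniz (K : Type*) [Field K] {L : Type*} [AddCommGroup L] [Module K L]
    (α : L → L) (b : L → L → L) : Prop :=
  IsLinearMap K α ∧ IsBilinMap K b ∧
  (∀ x y, α (b x y) = b (α x) (α y)) ∧
  (∀ x y z, b (α x) (b y z) = b (b x y) (α z) + b (α y) (b x z))

/-- A compatible Hom-Leibniz algebra structure `(L, b₁, b₂, α)`. -/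
def IsCompatibleHomLeibniz (K : Type*) [Field K] {L : Type*} [AddCommGroup L] [Module K L]
    (α : L → L) (b₁ b₂ : L → L → L) : Prop :=
  IsHomLeibniz K α b₁ ∧ IsHomLeibniz K α b₂ ∧
  (∀ x y z, b₁ (α x) (b₂ y z) + b₂ (α x) (b₁ y z) =
    b₁ (b₂ x y) (α z) + b₂ (b₁ x y) (α z) + b₁ (α y) (b₂ x z) + b₂ (α y) (b₁ x z))

/-- A bimodule `(M, mL, mR, β)` over the multiplicative Hom-Leibniz algebra `(L, b, α)`. -/
def IsHomLeibnizBimodule (K : Type*) [Field K] {L M : Type*} [AddCommGroup L] [Module K L]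
    [AddCommGroup M] [Module K M] (α : L → L) (b : L → L → L)
    (mL : L → M → M) (mR : M → L → M) (β : M → M) : Prop :=
  IsLinearMap K β ∧ IsBilinMap K mL ∧ IsBilinMap K mR ∧
  (∀ x m, β (mL x m) = mL (α x) (β m)) ∧
  (∀ m x, β (mR m x) = mR (β m) (α x)) ∧
  (∀ x y m, mL (α x) (mL y m) = mL (b x y) (β m) + mL (α y) (mL x m)) ∧
  (∀ x y m, mL (α x) (mR m y) = mR (mL x m) (α y) + mR (β m) (b x y)) ∧
  (∀ x y m, mR (β m) (b x y) = mR (mR m x) (α y) + mL (α x) (mR m y))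

/-- A compatible bimodule over the compatible Hom-Leibniz algebra `(L, b₁, b₂, α)`. -/
def IsCompatibleBimodule (K : Type*) [Field K] {L M : Type*} [AddCommGroup L] [Module K L]
    [AddCommGroup M] [Module K M] (α : L → L) (b₁ b₂ : L → L → L)
    (mL₁ mL₂ : L → M → M) (mR₁ mR₂ : M → L → M) (β : M → M) : Prop :=
  IsHomLeibnizBimodule K α b₁ mL₁ mR₁ β ∧
  IsHomLeibnizBimodule K α b₂ mL₂ mR₂ β ∧
  (∀ x y m, mL₁ (α x) (mL₂ y m) + mL₂ (α x) (mL₁ y m) =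
    mL₁ (b₂ x y) (β m) + mL₂ (b₁ x y) (β m) + mL₁ (α y) (mL₂ x m) + mL₂ (α y) (mL₁ x m)) ∧
  (∀ x y m, mL₁ (α x) (mR₂ m y) + mL₂ (α x) (mR₁ m y) =
    mR₁ (mL₂ x m) (α y) + mR₂ (mL₁ x m) (α y) + mR₁ (β m) (b₂ x y) + mR₂ (β m) (b₁ x y)) ∧
  (∀ x y m, mR₁ (β m) (b₂ x y) + mR₂ (β m) (b₁ x y) =
    mR₁ (mR₂ m x) (α y) + mR₂ (mR₁ m x) (α y) + mL₁ (α x) (mR₂ m y) + mL₂ (α x) (mR₁ m y))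

/-- Lift of the multiplication `π : L⊗L → L` to a 2-cochain on `L ⊕ M`. -/
def hatPi {L M : Type*} [AddCommGroup L] [AddCommGroup M] (b : L → L → L) :
    (Fin 2 → L × M) → L × M := fun x => (b (x 0).1 (x 1).1, 0)

/-- Lift of the left action `m_L : L⊗M → M` to a 2-cochain on `L ⊕ M`. -/
def hatML {L M : Type*} [AddCommGroup L] [AddCommGroup M] (mL : L → M → M) :
    (Fin 2 → L × M) → L × M := fun x => (0, mL (x 0).1 (x 1).2)

/-- Lift of the right action `m_R : M⊗L → M` to a 2-cochain on `L ⊕ M`. -/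
def hatMR {L M : Type*} [AddCommGroup L] [AddCommGroup M] (mR : M → L → M) :
    (Fin 2 → L × M) → L × M := fun x => (0, mR (x 0).2 (x 1).1)

theorem filter_isShuffle_zero_one :
    Finset.univ.filter (fun σ : Equiv.Perm (Fin (0 + 1)) => IsShuffle 0 σ) = {1} := by
  decide

theorem filter_isShuffle_one_one :
    Finset.univ.filter (fun σ : Equiv.Perm (Fin (1 + 1)) => IsShuffle 1 σ) =
      {1, Equiv.swap 0 1} := by
  decide

omit [Module K L] in
/-- The circle product of two 2-cochains. -/
theorem hcomp_one_one (α : L → L) (P Q : (Fin 2 → L) → L) (x : Fin 3 → L) :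
    hcomp α 1 1 P Q x =
      P ![Q ![x 0, x 1], α (x 2)] - P ![α (x 0), Q ![x 1, x 2]] +
        P ![α (x 1), Q ![x 0, x 2]] := by
  have hne : (1 : Equiv.Perm (Fin (1 + 1))) ∉ ({Equiv.swap 0 1} : Finset _) := by decide
  have key : hcomp α 1 1 P Q x =
      ((-1 : ℤ) ^ (0 * 1) • ∑ σ ∈ Finset.univ.filter
          (fun σ : Equiv.Perm (Fin (0 + 1)) => IsShuffle 0 σ), (Equiv.Perm.sign σ : ℤ) •
            P ![Q ![x (Fin.castLE (by omega) (σ 0)), x 1], α (x 2)]) +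
        (-1 : ℤ) ^ (1 * 1) • ∑ σ ∈ Finset.univ.filter
          (fun σ : Equiv.Perm (Fin (1 + 1)) => IsShuffle 1 σ), (Equiv.Perm.sign σ : ℤ) •
            P ![α (x (Fin.castLE (by omega) (σ 0))),
              Q ![x (Fin.castLE (by omega) (σ 1)), x 2]] := by
    refine (Fin.sum_univ_two _).trans (congrArg₂ _ ?_ ?_) <;>
    · refine congrArg _ (Finset.sum_congr rfl fun σ _ => congrArg _ (congrArg P ?_))
      funext i
      fin_cases i
      all_goals first
        | rfl
        | refine congrArg Q (funext fun a => ?_)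
          fin_cases a <;> rfl
  rw [key, filter_isShuffle_zero_one, filter_isShuffle_one_one, Finset.sum_singleton,
    Finset.sum_insert hne, Finset.sum_singleton, Equiv.Perm.sign_swap (by decide)]
  simp only [Equiv.Perm.sign_one, Equiv.Perm.one_apply, Equiv.swap_apply_left,
    Equiv.swap_apply_right, zero_mul, one_mul, pow_zero, pow_one, Units.val_one, Units.val_neg,
    one_smul, neg_smul, neg_add, neg_neg, ← add_assoc, sub_eq_add_neg]
  rfl

omit [Module K L] in
/-- The Balavoine bracket of two 2-cochains. -/
theorem balavoine_one_one (α : L → L) (P Q : (Fin 2 → L) → L) (x : Fin 3 → L) :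
    balavoine α 1 1 P Q x =
      (P ![Q ![x 0, x 1], α (x 2)] - P ![α (x 0), Q ![x 1, x 2]] +
        P ![α (x 1), Q ![x 0, x 2]]) +
      (Q ![P ![x 0, x 1], α (x 2)] - Q ![α (x 0), P ![x 1, x 2]] +
        Q ![α (x 1), P ![x 0, x 2]]) := by
  rw [← hcomp_one_one, ← hcomp_one_one, ← sub_neg_eq_add, ← neg_one_zsmul]
  rfl

omit [CharZero K] in
theorem IsHomLeibniz.compatible_self {α : L → L} {b : L → L → L} (h : IsHomLeibniz K α b) :
    IsCompatibleHomLeibniz K α b b := by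
  refine ⟨h, h, fun x y z => ?_⟩
  rw [h.2.2.2 x y z]
  abel

omit [CharZero K] in
theorem IsHomLeibnizBimodule.compatible_self {α : L → L} {b : L → L → L}
    {mL : L → M → M} {mR : M → L → M} {β : M → M}
    (h : IsHomLeibnizBimodule K α b mL mR β) :
    IsCompatibleBimodule K α b b mL mL mR mR β := by
  obtain ⟨-, -, -, -, -, hLL, hLR, hRR⟩ := id h
  refine ⟨h, h, fun x y m => ?_, fun x y m => ?_, fun x y m => ?_⟩
  · rw [hLL x y m]; abel
  · rw [hLR x y m]; abel
  · rw [hRR x y m]; abel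

omit [CharZero K] in
/-- The mixed Maurer–Cartan equation on `L ⊕ M`. -/
theorem balavoine_lift_eq_zero {α : L → L} {b₁ b₂ : L → L → L}
    (h : IsCompatibleHomLeibniz K α b₁ b₂)
    {mL₁ mL₂ : L → M → M} {mR₁ mR₂ : M → L → M} {β : M → M}
    (hM : IsCompatibleBimodule K α b₁ b₂ mL₁ mL₂ mR₁ mR₂ β) :
    balavoine (fun p : L × M => (α p.1, β p.2)) 1 1
        (hatPi b₁ + hatML mL₁ + hatMR mR₁) (hatPi b₂ + hatML mL₂ + hatMR mR₂) = 0 := by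
  obtain ⟨-, -, hb⟩ := h
  obtain ⟨⟨-, hL₁, hR₁, -⟩, ⟨-, hL₂, hR₂, -⟩, hLL, hLR, hRR⟩ := hM
  funext (x : Fin 3 → L × M)
  rw [balavoine_one_one]
  ext
  · simp only [hatPi, hatML, hatMR, Pi.add_apply, Pi.zero_apply, Matrix.cons_val_zero,
      Matrix.cons_val_one, Prod.fst_add, Prod.fst_sub, Prod.fst_zero, add_zero]
    linear_combination (norm := module) -hb (x 0).1 (x 1).1 (x 2).1
  · simp only [hatPi, hatML, hatMR, Pi.add_apply, Pi.zero_apply, Matrix.cons_val_zero,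
      Matrix.cons_val_one, Prod.fst_add, Prod.snd_add, Prod.snd_sub, Prod.snd_zero, add_zero,
      zero_add, (hL₁.1 _).map_add, (hR₁.2 _).map_add, (hL₂.1 _).map_add, (hR₂.2 _).map_add]
    linear_combination (norm := module) -hLL (x 0).1 (x 1).1 (x 2).2 -
      hLR (x 0).1 (x 2).1 (x 1).2 - hRR (x 1).1 (x 2).1 (x 0).2

/-- For a compatible Hom-Leibniz algebra `(L,π₁,π₂,α)` and a
compatible bimodule `(M,m_L^1,m_R^1,m_L^2,m_R^2,β)`, the pair
`(π̂₁+m̂_L^1+m̂_R^1, π̂₂+m̂_L^2+m̂_R^2)` is a Maurer–Cartan element of the b-dgLa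
`(C_{α⊕β}^*(L⊕M,L⊕M), [·,·]_B, 0, 0)`: the three displayed brackets vanish. -/
theorem compatible_bimodule_maurerCartan
    (α : L → L) (b₁ b₂ : L → L → L) (h : IsCompatibleHomLeibniz K α b₁ b₂)
    (mL₁ mL₂ : L → M → M) (mR₁ mR₂ : M → L → M) (β : M → M)
    (hM : IsCompatibleBimodule K α b₁ b₂ mL₁ mL₂ mR₁ mR₂ β) :
    balavoine (fun p : L × M => (α p.1, β p.2)) 1 1
        (hatPi b₁ + hatML mL₁ + hatMR mR₁) (hatPi b₁ + hatML mL₁ + hatMR mR₁) = 0 ∧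
    balavoine (fun p : L × M => (α p.1, β p.2)) 1 1
        (hatPi b₁ + hatML mL₁ + hatMR mR₁) (hatPi b₂ + hatML mL₂ + hatMR mR₂) = 0 ∧
    balavoine (fun p : L × M => (α p.1, β p.2)) 1 1
        (hatPi b₂ + hatML mL₂ + hatMR mR₂) (hatPi b₂ + hatML mL₂ + hatMR mR₂) = 0 := by
  exact ⟨balavoine_lift_eq_zero h.1.compatible_self hM.1.compatible_self,
    balavoine_lift_eq_zero h hM,
    balavoine_lift_eq_zero h.2.1.compatible_self hM.2.1.compatible_self⟩
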